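/- Fix nonnegative cell wave speeds β_j. For every u ∈ V^k, every real λ ≠ 0, and every μ ∈ ℝ: if u_σ(·,t̂) solves the damping initial value problem with initial data u, then λu_σ(·,t̂) + μ solves the damping initial value problem with initial data λu + μ (whose damping coefficients σ_j^m(λu+μ) coincide with σ_j^m(u)); consequently F_τ(λu + μ) = λ F_τ(u) + μ. (Scale invariance of the OE operator; Theorem 2.1, second part.) -/

import Mathlib

open Polynomial Finset MeasureTheory

namespace OEDG

variable {N : ℕ}

/-- `pt` lists the nodes `x_{1/2} < x_{3/2} < … < x_{N+1/2}` of a partition of `Ω = [0,1]`. -/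
def IsMesh (pt : Fin (N+1) → ℝ) : Prop :=
  pt 0 = 0 ∧ pt (Fin.last N) = 1 ∧ StrictMono pt

/-- Left endpoint of cell `j`. -/
def ptL (pt : Fin (N+1) → ℝ) (j : Fin N) : ℝ := pt j.castSucc

/-- Right endpoint of cell `j`. -/
def ptR (pt : Fin (N+1) → ℝ) (j : Fin N) : ℝ := pt j.succ

/-- Length `h_j` of cell `j`. -/
def cellh (pt : Fin (N+1) → ℝ) (j : Fin N) : ℝ := ptR pt j - ptL pt j

/-- Maximal mesh size `h`. -/
noncomputable def meshSize (pt : Fin (N+1) → ℝ) : ℝ := ⨆ j : Fin N, cellh pt j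

/-- Quasi-uniformity of the partition: `h ≤ γ h_j` for all `j`. -/
def QuasiUniform (pt : Fin (N+1) → ℝ) (γ : ℝ) : Prop :=
  ∀ j : Fin N, meshSize pt ≤ γ * cellh pt j

/-- Membership in `V^k`: every cell polynomial has degree at most `k`. -/
def MemVk (k : ℕ) (u : Fin N → Polynomial ℝ) : Prop :=
  ∀ j, (u j).natDegree ≤ k

/-- Cellwise `L²` inner product. -/
noncomputable def cip (pt : Fin (N+1) → ℝ) (j : Fin N) (p q : Polynomial ℝ) : ℝ :=
  ∫ x in (ptL pt j)..(ptR pt j), p.eval x * q.eval x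

/-- Global `L²(Ω)` inner product of piecewise polynomials. -/
noncomputable def ip (pt : Fin (N+1) → ℝ) (u v : Fin N → Polynomial ℝ) : ℝ :=
  ∑ j : Fin N, cip pt j (u j) (v j)

/-- Cellwise `L²` norm. -/
noncomputable def cl2 (pt : Fin (N+1) → ℝ) (j : Fin N) (p : Polynomial ℝ) : ℝ :=
  Real.sqrt (cip pt j p p)

/-- Global `L²(Ω)` norm of a piecewise polynomial. -/
noncomputable def l2 (pt : Fin (N+1) → ℝ) (u : Fin N → Polynomial ℝ) : ℝ :=
  Real.sqrt (ip pt u u)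

/-- Average `avg(u) = (1/|Ω|) ∫_Ω u dx` (here `|Ω| = 1`). -/
noncomputable def avg (pt : Fin (N+1) → ℝ) (u : Fin N → Polynomial ℝ) : ℝ :=
  ∑ j : Fin N, ∫ x in (ptL pt j)..(ptR pt j), (u j).eval x

/-- `‖u - c‖_{L∞(Ω)}` for a piecewise polynomial `u` and a constant `c`. -/
noncomputable def linfSub (pt : Fin (N+1) → ℝ) (u : Fin N → Polynomial ℝ) (c : ℝ) : ℝ :=
  ⨆ j : Fin N, sSup ((fun x => |(u j).eval x - c|) '' Set.Icc (ptL pt j) (ptR pt j))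

/-- `m`-th derivative of a polynomial. -/
noncomputable def pderiv (m : ℕ) (p : Polynomial ℝ) : Polynomial ℝ :=
  (fun q : Polynomial ℝ => Polynomial.derivative q)^[m] p

/-- Jump `[∂_x^m u]_{j+1/2}` of the `m`-th derivative at the interface to the right of
cell `j`, with periodic identification of `x_{N+1/2}` with `x_{1/2}`. -/
noncomputable def jumpD [NeZero N] (pt : Fin (N+1) → ℝ) (u : Fin N → Polynomial ℝ)
    (m : ℕ) (j : Fin N) : ℝ :=
  (pderiv m (u (j+1))).eval (pt (Fin.castSucc (j+1))) - (pderiv m (u j)).eval (pt j.succ)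

/-- The scale-invariant damping coefficient `σ_j^m(u)` of the OEDG method. -/
noncomputable def sigma [NeZero N] (k : ℕ) (pt : Fin (N+1) → ℝ)
    (u : Fin N → Polynomial ℝ) (m : ℕ) (j : Fin N) : ℝ :=
  if ∀ i, u i = Polynomial.C (avg pt u) then 0
  else (2*(m:ℝ)+1) * (cellh pt j)^m / ((2*(k:ℝ)-1) * (Nat.factorial m)) *
    ((|jumpD pt u m (j-1)| + |jumpD pt u m j|) / (2 * linfSub pt u (avg pt u)))

/-- Damping rate `δ_j^m = β_j σ_j^m(u) / h_j`. -/
noncomputable def dampRate [NeZero N] (k : ℕ) (pt : Fin (N+1) → ℝ) (β : Fin N → ℝ)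
    (u : Fin N → Polynomial ℝ) (m : ℕ) (j : Fin N) : ℝ :=
  β j * sigma k pt u m j / cellh pt j

/-- `Pc j d` is the cellwise `L²(I_j)`-orthogonal projection onto `ℙ^d(I_j)`.
(The family `Pc` realizes the global projections `P^d` onto `V^d`.) -/
def IsCellProj (pt : Fin (N+1) → ℝ)
    (Pc : Fin N → ℕ → Polynomial ℝ → Polynomial ℝ) : Prop :=
  ∀ (j : Fin N) (dd : ℕ) (p : Polynomial ℝ), (Pc j dd p).natDegree ≤ dd ∧
    ∀ q : Polynomial ℝ, q.natDegree ≤ dd → cip pt j (p - Pc j dd p) q = 0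

/-- `w` solves the damping initial value problem with initial data `u`:
`d/dt̂ ∫_{I_j} u_σ v dx + ∑_{m=0}^k (β_j σ_j^m(u)/h_j) ∫_{I_j} (u_σ - P^{m-1} u_σ) v dx = 0`
for every `v ∈ ℙ^k(I_j)` and every `j`, with `u_σ(·,0) = u`.  (Note `m - 1` is
truncated ℕ-subtraction, which realizes the convention `P^{-1} = P^0`.) -/
def IsDampingSol [NeZero N] (k : ℕ) (pt : Fin (N+1) → ℝ) (β : Fin N → ℝ)
    (Pc : Fin N → ℕ → Polynomial ℝ → Polynomial ℝ)
    (u : Fin N → Polynomial ℝ) (w : ℝ → Fin N → Polynomial ℝ) : Prop :=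
  w 0 = u ∧ (∀ t j, (w t j).natDegree ≤ k) ∧
  ∀ (t : ℝ) (j : Fin N) (v : Polynomial ℝ), v.natDegree ≤ k →
    HasDerivAt (fun s => cip pt j (w s j) v)
      (-(∑ m ∈ Finset.range (k+1),
        dampRate k pt β u m j * cip pt j (w t j - Pc j (m-1) (w t j)) v)) t

/-- `Fτ` is the OE (oscillation-eliminating) operator: for every `u ∈ V^k` the damping
initial value problem has a solution `w` and `Fτ u = w τ`. -/
def IsOEOp [NeZero N] (k : ℕ) (pt : Fin (N+1) → ℝ) (β : Fin N → ℝ)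
    (Pc : Fin N → ℕ → Polynomial ℝ → Polynomial ℝ) (τ : ℝ)
    (Fτ : (Fin N → Polynomial ℝ) → (Fin N → Polynomial ℝ)) : Prop :=
  ∀ u, MemVk k u → ∃ w, IsDampingSol k pt β Pc u w ∧ Fτ u = w τ

/-- Right-hand side of the weak form of the upwind DG operator for `u_t + β u_x = 0`:
`β ∫_{I_j} w v_x dx - β w(x_{j+1/2}^-) v(x_{j+1/2}^-) + β w(x_{j-1/2}^-) v(x_{j-1/2}^+)`. -/
noncomputable def dgRHS [NeZero N] (pt : Fin (N+1) → ℝ) (β : ℝ)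
    (w : Fin N → Polynomial ℝ) (j : Fin N) (v : Polynomial ℝ) : ℝ :=
  β * (∫ x in (ptL pt j)..(ptR pt j), (w j).eval x * (Polynomial.derivative v).eval x)
  - β * (w j).eval (ptR pt j) * v.eval (ptR pt j)
  + β * (w (j-1)).eval (pt (j-1).succ) * v.eval (ptL pt j)

/-- `L` is the upwind DG spatial operator on `V^k`. -/
def IsDGOp [NeZero N] (k : ℕ) (pt : Fin (N+1) → ℝ) (β : ℝ)
    (L : (Fin N → Polynomial ℝ) → (Fin N → Polynomial ℝ)) : Prop :=
  ∀ w, MemVk k w → MemVk k (L w) ∧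
    ∀ (j : Fin N) (v : Polynomial ℝ), v.natDegree ≤ k →
      cip pt j (L w j) v = dgRHS pt β w j v

/-- The upwind DG bilinear form
`H(w,v) = β ∑_j ∫_{I_j} w v_x dx + β ∑_j w(x_{j+1/2}^-) [v]_{j+1/2}`. -/
noncomputable def Hform [NeZero N] (pt : Fin (N+1) → ℝ) (β : ℝ)
    (w v : Fin N → Polynomial ℝ) : ℝ :=
  β * ∑ j : Fin N, (∫ x in (ptL pt j)..(ptR pt j),
      (w j).eval x * (Polynomial.derivative (v j)).eval x)
  + β * ∑ j : Fin N, (w j).eval (ptR pt j) * jumpD pt v 0 j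

/-- The upwind DG bilinear form with piecewise-smooth first argument. -/
noncomputable def HformF [NeZero N] (pt : Fin (N+1) → ℝ) (β : ℝ)
    (w : Fin N → ℝ → ℝ) (v : Fin N → Polynomial ℝ) : ℝ :=
  β * ∑ j : Fin N, (∫ x in (ptL pt j)..(ptR pt j),
      w j x * (Polynomial.derivative (v j)).eval x)
  + β * ∑ j : Fin N, w j (ptR pt j) * jumpD pt v 0 j

/-- `L²(Ω)` pairing of a piecewise-smooth function with a piecewise polynomial. -/
noncomputable def ipF (pt : Fin (N+1) → ℝ) (w : Fin N → ℝ → ℝ)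
    (v : Fin N → Polynomial ℝ) : ℝ :=
  ∑ j : Fin N, ∫ x in (ptL pt j)..(ptR pt j), w j x * (v j).eval x

/-- One Runge–Kutta stage: `∑_{0≤m≤ℓ} (c_{ℓm} u_σ^{n,m} + τ d_{ℓm} L(u_σ^{n,m}))`. -/
noncomputable def rkStage [NeZero N] (c d : ℕ → ℕ → ℝ) (τ : ℝ)
    (L : (Fin N → Polynomial ℝ) → (Fin N → Polynomial ℝ))
    (uσ : ℕ → Fin N → Polynomial ℝ) (ℓ : ℕ) : Fin N → Polynomial ℝ :=
  fun j => ∑ m ∈ Finset.range (ℓ+1),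
    (Polynomial.C (c ℓ m) * uσ m j + Polynomial.C (τ * d ℓ m) * L (uσ m) j)

/-- One full OEDG time step from `u_σ^n = un`: the stages `u_h^{n,ℓ+1}` and
`u_σ^{n,ℓ+1} = F_τ u_h^{n,ℓ+1}`, `0 ≤ ℓ ≤ s-1`. -/
def IsOEDGStep [NeZero N] (s : ℕ) (c d : ℕ → ℕ → ℝ) (τ : ℝ)
    (L Fτ : (Fin N → Polynomial ℝ) → (Fin N → Polynomial ℝ))
    (un : Fin N → Polynomial ℝ) (uh uσ : ℕ → Fin N → Polynomial ℝ) : Prop :=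
  uσ 0 = un ∧ ∀ ℓ < s, uh (ℓ+1) = rkStage c d τ L uσ ℓ ∧ uσ (ℓ+1) = Fτ (uh (ℓ+1))

/-- The full OEDG evolution: `uσ n ℓ = u_σ^{n,ℓ}` and `uh n ℓ = u_h^{n,ℓ}`, starting from
`u_σ^0 = u0`, with `u_σ^{n+1} = u_σ^{n,s}`. -/
def IsOEDGEvol [NeZero N] (s : ℕ) (c d : ℕ → ℕ → ℝ) (τ : ℝ)
    (L Fτ : (Fin N → Polynomial ℝ) → (Fin N → Polynomial ℝ))
    (u0 : Fin N → Polynomial ℝ) (uh uσ : ℕ → ℕ → Fin N → Polynomial ℝ) : Prop :=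
  uσ 0 0 = u0 ∧ ∀ n, uσ (n+1) 0 = uσ n s ∧
    ∀ ℓ < s, uh n (ℓ+1) = rkStage c d τ L (uσ n) ℓ ∧ uσ n (ℓ+1) = Fτ (uh n (ℓ+1))

/-- `p` is the Gauss–Radau projection of `w` on `[a,b]` into `ℙ^k`:
`∫_a^b (w - p) q dx = 0` for all `q ∈ ℙ^{k-1}` and `p(b) = w(b)`. -/
def IsGRProj (k : ℕ) (a b : ℝ) (w : ℝ → ℝ) (p : Polynomial ℝ) : Prop :=
  p.natDegree ≤ k ∧
  (∀ q : Polynomial ℝ, q.natDegree < k →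
    (∫ x in a..b, (w x - p.eval x) * q.eval x) = 0) ∧
  p.eval b = w b

/-- `u = u(x,t)` is a smooth `1`-periodic exact solution of `u_t + β u_x = 0`. -/
def IsSmoothSolution (β : ℝ) (u : ℝ → ℝ → ℝ) : Prop :=
  ContDiff ℝ (⊤ : ℕ∞) (fun p : ℝ × ℝ => u p.1 p.2) ∧
  (∀ x t, u (x+1) t = u x t) ∧
  (∀ x t, deriv (fun s => u x s) t + β * deriv (fun y => u y t) x = 0)

/-- Auxiliary table for the reference functions `U^{n,ℓ}`. -/
noncomputable def UrefUpTo (u : ℝ → ℝ → ℝ) (c d : ℕ → ℕ → ℝ) (β τ : ℝ) (n : ℕ) :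
    ℕ → ℕ → ℝ → ℝ
  | 0 => fun _ => fun x => u x ((n:ℝ) * τ)
  | (ℓ+1) => fun i =>
      if i ≤ ℓ then UrefUpTo u c d β τ n ℓ i
      else fun x => ∑ m ∈ Finset.range (ℓ+1),
        (c ℓ m * UrefUpTo u c d β τ n ℓ m x
          - τ * d ℓ m * β * deriv (UrefUpTo u c d β τ n ℓ m) x)

/-- Reference function `U^{n,ℓ}` (for `0 ≤ ℓ ≤ s-1`): `U^{n,0} = u(·, t^n)` and
`U^{n,ℓ+1} = ∑_{0≤m≤ℓ} (c_{ℓm} U^{n,m} - τ d_{ℓm} β ∂_x U^{n,m})`. -/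
noncomputable def Uref (u : ℝ → ℝ → ℝ) (c d : ℕ → ℕ → ℝ) (β τ : ℝ) (n ℓ : ℕ) : ℝ → ℝ :=
  UrefUpTo u c d β τ n ℓ ℓ

/-- Reference function `U^{n,ℓ}` including the final stage `U^{n,s} := u(·, t^{n+1})`. -/
noncomputable def UrefS (u : ℝ → ℝ → ℝ) (c d : ℕ → ℕ → ℝ) (β τ : ℝ) (s n ℓ : ℕ) : ℝ → ℝ :=
  if ℓ = s then fun x => u x (((n:ℝ)+1) * τ) else Uref u c d β τ n ℓ

/-- The Runge–Kutta residual `ρ^{n,s-1}`, defined so that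
`U^{n,s} = ∑_{0≤m≤s-1} (c_{s-1,m} U^{n,m} - τ d_{s-1,m} β ∂_x U^{n,m}) + τ ρ^{n,s-1}`. -/
noncomputable def rkRes (u : ℝ → ℝ → ℝ) (c d : ℕ → ℕ → ℝ) (β τ : ℝ) (s n : ℕ) : ℝ → ℝ :=
  fun x => (u x (((n:ℝ)+1) * τ) - ∑ m ∈ Finset.range s,
    (c (s-1) m * Uref u c d β τ n m x
      - τ * d (s-1) m * β * deriv (Uref u c d β τ n m) x)) / τ

/-- `L²(0,1)` norm of a function. -/
noncomputable def fl2 (f : ℝ → ℝ) : ℝ := Real.sqrt (∫ x in (0:ℝ)..1, (f x)^2)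

/-- `L²(Ω)` distance between a piecewise polynomial and a function. -/
noncomputable def errL2 (pt : Fin (N+1) → ℝ) (w : Fin N → Polynomial ℝ) (f : ℝ → ℝ) : ℝ :=
  Real.sqrt (∑ j : Fin N, ∫ x in (ptL pt j)..(ptR pt j), ((w j).eval x - f x)^2)


section CellInnerProduct

variable (pt : Fin (N+1) → ℝ) (j : Fin N)

theorem cip_comm (p q : Polynomial ℝ) : cip pt j p q = cip pt j q p := by
  simp only [cip, mul_comm]

theorem cip_add_left (p q v : Polynomial ℝ) :
    cip pt j (p + q) v = cip pt j p v + cip pt j q v := by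
  simp only [cip, Polynomial.eval_add, add_mul]
  exact intervalIntegral.integral_add
    ((p.continuous.mul v.continuous).intervalIntegrable _ _)
    ((q.continuous.mul v.continuous).intervalIntegrable _ _)

theorem cip_C_mul_left (a : ℝ) (p v : Polynomial ℝ) :
    cip pt j (Polynomial.C a * p) v = a * cip pt j p v := by
  simp only [cip, Polynomial.eval_mul, Polynomial.eval_C, mul_assoc]
  exact intervalIntegral.integral_const_mul _ _

theorem cip_sub_left (p q v : Polynomial ℝ) :
    cip pt j (p - q) v = cip pt j p v - cip pt j q v := by
  rw [eq_sub_iff_add_eq, ← cip_add_left, sub_add_cancel]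

theorem cip_add_right (p q v : Polynomial ℝ) :
    cip pt j v (p + q) = cip pt j v p + cip pt j v q := by
  simp only [cip_comm pt j v, cip_add_left]

variable {pt}

theorem IsMesh.ptL_lt_ptR (hpt : IsMesh pt) (j : Fin N) : ptL pt j < ptR pt j :=
  hpt.2.2 j.castSucc_lt_succ

theorem eq_zero_of_cip_self_eq_zero (hpt : IsMesh pt) {p : Polynomial ℝ}
    (h : cip pt j p p = 0) : p = 0 := by
  have hlt := hpt.ptL_lt_ptR j
  have hzero : ∀ x ∈ Set.Icc (ptL pt j) (ptR pt j), p.eval x = 0 := by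
    by_contra! hne
    obtain ⟨x, hx, hpx⟩ := hne
    have hpos := intervalIntegral.integral_pos (f := fun x => p.eval x * p.eval x) hlt
      (p.continuous.mul p.continuous).continuousOn (fun y _ => mul_self_nonneg _)
      ⟨x, hx, mul_self_pos.2 hpx⟩
    exact hpos.ne' h
  exact Polynomial.eq_zero_of_infinite_isRoot p
    ((Set.Icc_infinite hlt).mono fun x hx => hzero x hx)

/-- A polynomial of degree at most `d` is determined by its moments against `ℙ^d`. -/
theorem eq_of_forall_cip_eq (hpt : IsMesh pt) {d : ℕ} {p q : Polynomial ℝ}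
    (hp : p.natDegree ≤ d) (hq : q.natDegree ≤ d)
    (h : ∀ v : Polynomial ℝ, v.natDegree ≤ d → cip pt j p v = cip pt j q v) : p = q := by
  refine sub_eq_zero.1 (eq_zero_of_cip_self_eq_zero j hpt ?_)
  rw [cip_sub_left, sub_eq_zero]
  exact h _ ((Polynomial.natDegree_sub_le_of_le hp hq).trans (max_self d).le)

end CellInnerProduct

theorem natDegree_C_mul_add_C_le {d : ℕ} {p : Polynomial ℝ} (hp : p.natDegree ≤ d) (a b : ℝ) :
    (Polynomial.C a * p + Polynomial.C b).natDegree ≤ d := by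
  rw [Polynomial.natDegree_add_C]
  exact (Polynomial.natDegree_C_mul_le _ _).trans hp

theorem IsCellProj.map_C_mul_add_C {pt : Fin (N+1) → ℝ} (hpt : IsMesh pt)
    {Pc : Fin N → ℕ → Polynomial ℝ → Polynomial ℝ} (hPc : IsCellProj pt Pc)
    (j : Fin N) (d : ℕ) (p : Polynomial ℝ) (a b : ℝ) :
    Pc j d (Polynomial.C a * p + Polynomial.C b)
      = Polynomial.C a * Pc j d p + Polynomial.C b := by
  refine eq_of_forall_cip_eq j hpt (hPc j d _).1
    (natDegree_C_mul_add_C_le (hPc j d p).1 a b) fun v hv => ?_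
  have h₁ := (hPc j d (Polynomial.C a * p + Polynomial.C b)).2 v hv
  have h₂ := (hPc j d p).2 v hv
  simp only [cip_sub_left, cip_add_left, cip_C_mul_left] at h₁ h₂ ⊢
  linear_combination a * h₂ - h₁

section Sigma

theorem avg_C_mul_add_C {pt : Fin (N+1) → ℝ} (hpt : IsMesh pt) (u : Fin N → Polynomial ℝ)
    (a b : ℝ) :
    avg pt (fun i => Polynomial.C a * u i + Polynomial.C b) = a * avg pt u + b := by
  have hcell : ∀ j : Fin N,
      (∫ x in (ptL pt j)..(ptR pt j), (Polynomial.C a * u j + Polynomial.C b).eval x)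
        = a * (∫ x in (ptL pt j)..(ptR pt j), (u j).eval x)
          + (pt j.succ - pt j.castSucc) * b := by
    intro j
    simp only [Polynomial.eval_add, Polynomial.eval_mul, Polynomial.eval_C]
    rw [intervalIntegral.integral_add
      (((u j).continuous.intervalIntegrable _ _).const_mul a)
      (continuous_const.intervalIntegrable _ _)]
    simp [ptL, ptR]
  have htel : ∑ j : Fin N, (pt j.succ - pt j.castSucc) = 1 := by
    have h₁ := Fin.sum_univ_succ pt
    have h₂ := Fin.sum_univ_castSucc pt
    rw [hpt.1] at h₁
    rw [hpt.2.1] at h₂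
    rw [Finset.sum_sub_distrib]
    linarith
  simp only [avg, hcell]
  rw [Finset.sum_add_distrib, ← Finset.mul_sum, ← Finset.sum_mul, htel, one_mul]

theorem linfSub_C_mul_add_C (pt : Fin (N+1) → ℝ) (u : Fin N → Polynomial ℝ) (a b c : ℝ) :
    linfSub pt (fun i => Polynomial.C a * u i + Polynomial.C b) (a * c + b)
      = |a| * linfSub pt u c := by
  simp only [linfSub]
  rw [Real.mul_iSup_of_nonneg (abs_nonneg a)]
  congr 1
  funext j
  rw [← smul_eq_mul |a|, ← Real.sSup_smul_of_nonneg (abs_nonneg a), ← Set.image_smul,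
    Set.image_image]
  congr 1
  refine Set.image_congr fun x _ => ?_
  rw [smul_eq_mul, ← abs_mul]
  simp only [Polynomial.eval_add, Polynomial.eval_mul, Polynomial.eval_C]
  congr 1
  ring

theorem jumpD_C_mul_add_C [NeZero N] (pt : Fin (N+1) → ℝ) (u : Fin N → Polynomial ℝ)
    (a b : ℝ) (m : ℕ) (j : Fin N) :
    jumpD pt (fun i => Polynomial.C a * u i + Polynomial.C b) m j = a * jumpD pt u m j := by
  have hderiv : ∀ p : Polynomial ℝ, pderiv m p = Polynomial.derivative^[m] p := fun _ => rfl
  simp only [jumpD, hderiv, iterate_map_add,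
    Polynomial.iterate_derivative_C_mul, Polynomial.eval_add, Polynomial.eval_mul,
    Polynomial.eval_C]
  rcases m with _ | m
  · simp only [Function.iterate_zero, id, Polynomial.eval_C]
    ring
  · rw [Polynomial.iterate_derivative_C m.succ_pos]
    simp only [Polynomial.eval_zero]
    ring

theorem sigma_C_mul_add_C [NeZero N] (k : ℕ) {pt : Fin (N+1) → ℝ} (hpt : IsMesh pt)
    (u : Fin N → Polynomial ℝ) {a : ℝ} (ha : a ≠ 0) (b : ℝ) (m : ℕ) (j : Fin N) :
    sigma k pt (fun i => Polynomial.C a * u i + Polynomial.C b) m j = sigma k pt u m j := by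
  have hiff : (∀ i, Polynomial.C a * u i + Polynomial.C b = Polynomial.C (a * avg pt u + b))
      ↔ ∀ i, u i = Polynomial.C (avg pt u) := by
    refine forall_congr' fun i => ?_
    rw [Polynomial.C_add, Polynomial.C_mul, add_left_inj]
    exact mul_right_inj' (Polynomial.C_ne_zero.2 ha)
  simp only [sigma, avg_C_mul_add_C hpt, hiff, linfSub_C_mul_add_C, jumpD_C_mul_add_C, abs_mul]
  rw [← mul_add, mul_left_comm 2, mul_div_mul_left _ _ (abs_ne_zero.2 ha)]

end Sigma

theorem IsDampingSol.C_mul_add_C [NeZero N] {k : ℕ} {pt : Fin (N+1) → ℝ} (hpt : IsMesh pt)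
    {β : Fin N → ℝ} {Pc : Fin N → ℕ → Polynomial ℝ → Polynomial ℝ} (hPc : IsCellProj pt Pc)
    {u : Fin N → Polynomial ℝ} {w : ℝ → Fin N → Polynomial ℝ}
    (hw : IsDampingSol k pt β Pc u w) {a : ℝ} (ha : a ≠ 0) (b : ℝ) :
    IsDampingSol k pt β Pc (fun i => Polynomial.C a * u i + Polynomial.C b)
      (fun t i => Polynomial.C a * w t i + Polynomial.C b) := by
  obtain ⟨h0, hdeg, hder⟩ := hw
  refine ⟨by simp only [h0], fun t j => natDegree_C_mul_add_C_le (hdeg t j) a b,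
    fun t j v hv => ?_⟩
  simp only [dampRate, sigma_C_mul_add_C k hpt u ha, hPc.map_C_mul_add_C hpt,
    add_sub_add_right_eq_sub, ← mul_sub, cip_add_left, cip_C_mul_left]
  refine (((hder t j v hv).const_mul a).add_const (cip pt j (Polynomial.C b) v)).congr_deriv ?_
  rw [mul_neg, Finset.mul_sum]
  congr 1
  refine Finset.sum_congr rfl fun m _ => ?_
  rw [dampRate]
  ring

/-- The zero function is the only solution of `f' = -c f` vanishing at the origin. -/
theorem eq_zero_of_hasDerivAt_neg_mul {f : ℝ → ℝ} {c : ℝ}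
    (hf : ∀ t, HasDerivAt f (-(c * f t)) t) (h0 : f 0 = 0) (t : ℝ) : f t = 0 := by
  have hexp : ∀ s, HasDerivAt (fun s => f s * Real.exp (c * s)) 0 s := by
    intro s
    refine ((hf s).mul ((hasDerivAt_id' s).const_mul c).exp).congr_deriv ?_
    ring
  have hconst := is_const_of_deriv_eq_zero (fun s => (hexp s).differentiableAt)
    (fun s => (hexp s).deriv) t 0
  simpa [h0, Real.exp_ne_zero] using hconst

/-- A test polynomial of degree at most `d + 1` orthogonal to `ℙ^d` diagonalizes the damping
operator. -/
theorem IsCellProj.sum_mul_cip_sub_eq {pt : Fin (N+1) → ℝ}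
    {Pc : Fin N → ℕ → Polynomial ℝ → Polynomial ℝ} (hPc : IsCellProj pt Pc) (j : Fin N)
    (s : Finset ℕ) (δ : ℕ → ℝ) {d : ℕ} {z : Polynomial ℝ} (hz : z.natDegree ≤ d + 1)
    (horth : ∀ q : Polynomial ℝ, q.natDegree ≤ d → cip pt j z q = 0) (p : Polynomial ℝ) :
    ∑ m ∈ s, δ m * cip pt j (p - Pc j (m - 1) p) z
      = (∑ m ∈ s, if m - 1 ≤ d then δ m else 0) * cip pt j p z := by
  rw [Finset.sum_mul]
  refine Finset.sum_congr rfl fun m _ => ?_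
  split_ifs with hm
  · rw [cip_sub_left, cip_comm pt j (Pc j (m - 1) p), horth _ ((hPc j _ p).1.trans hm), sub_zero]
  · rw [(hPc j (m - 1) p).2 z (by omega), mul_zero, zero_mul]

theorem IsDampingSol.unique [NeZero N] {k : ℕ} {pt : Fin (N+1) → ℝ} (hpt : IsMesh pt)
    {β : Fin N → ℝ} {Pc : Fin N → ℕ → Polynomial ℝ → Polynomial ℝ} (hPc : IsCellProj pt Pc)
    {u : Fin N → Polynomial ℝ} {w₁ w₂ : ℝ → Fin N → Polynomial ℝ}
    (h₁ : IsDampingSol k pt β Pc u w₁) (h₂ : IsDampingSol k pt β Pc u w₂) : w₁ = w₂ := by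
  obtain ⟨h₁0, h₁deg, h₁der⟩ := h₁
  obtain ⟨h₂0, h₂deg, h₂der⟩ := h₂
  funext t j
  have hscalar : ∀ (z : Polynomial ℝ) (c : ℝ), z.natDegree ≤ k →
      (∀ p : Polynomial ℝ, ∑ m ∈ Finset.range (k+1),
        dampRate k pt β u m j * cip pt j (p - Pc j (m - 1) p) z = c * cip pt j p z) →
      cip pt j (w₁ t j) z = cip pt j (w₂ t j) z := by
    intro z c hz hc
    refine sub_eq_zero.1 (eq_zero_of_hasDerivAt_neg_mul
      (f := fun s => cip pt j (w₁ s j) z - cip pt j (w₂ s j) z) (c := c) (fun s => ?_) ?_ t)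
    · refine ((h₁der s j z hz).sub (h₂der s j z hz)).congr_deriv ?_
      rw [hc, hc]
      ring
    · simp only [h₁0, h₂0, sub_self]
  have hmoments : ∀ d ≤ k, ∀ v : Polynomial ℝ, v.natDegree ≤ d →
      cip pt j (w₁ t j) v = cip pt j (w₂ t j) v := by
    intro d
    induction d with
    | zero =>
      intro hd v hv
      refine hscalar v 0 (hv.trans hd) fun p => ?_
      rw [zero_mul]
      exact Finset.sum_eq_zero fun m _ => by
        rw [(hPc j (m - 1) p).2 v (hv.trans (Nat.zero_le _)), mul_zero]
    | succ d ih =>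
      intro hd v hv
      obtain ⟨hPdeg, hPorth⟩ := hPc j d v
      have hz : (v - Pc j d v).natDegree ≤ d + 1 :=
        (Polynomial.natDegree_sub_le_of_le hv (hPdeg.trans d.le_succ)).trans (max_self _).le
      rw [← sub_add_cancel v (Pc j d v), cip_add_right, cip_add_right,
        ih (d.le_succ.trans hd) _ hPdeg,
        hscalar _ _ (hz.trans hd) (hPc.sum_mul_cip_sub_eq j _ _ hz hPorth)]
  exact eq_of_forall_cip_eq j hpt (h₁deg t j) (h₂deg t j) (hmoments k le_rfl)

/-- Theorem 2.1, second part: scale invariance of the OE operator.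
If `u_σ` solves the damping IVP with initial data `u`, then `λ u_σ + μ` solves the
damping IVP with initial data `λu + μ` (whose damping coefficients coincide with those
of `u`); consequently `F_τ(λu + μ) = λ F_τ(u) + μ`. -/
theorem oe_operator_scale_invariant
    {N : ℕ} [NeZero N] (k : ℕ) (pt : Fin (N+1) → ℝ) (hpt : IsMesh pt)
    (β : Fin N → ℝ) (hβ : ∀ j, 0 ≤ β j)
    (Pc : Fin N → ℕ → Polynomial ℝ → Polynomial ℝ) (hPc : IsCellProj pt Pc)
    (τ : ℝ) (hτ : 0 < τ)
    (u : Fin N → Polynomial ℝ) (hu : MemVk k u)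
    (lam mu : ℝ) (hlam : lam ≠ 0) :
    (∀ (j : Fin N) (m : ℕ), m ≤ k →
        sigma k pt (fun i => Polynomial.C lam * u i + Polynomial.C mu) m j
          = sigma k pt u m j) ∧
    (∀ w : ℝ → Fin N → Polynomial ℝ, IsDampingSol k pt β Pc u w →
        IsDampingSol k pt β Pc (fun i => Polynomial.C lam * u i + Polynomial.C mu)
          (fun t i => Polynomial.C lam * w t i + Polynomial.C mu)) ∧
    (∀ Fτ : (Fin N → Polynomial ℝ) → (Fin N → Polynomial ℝ), IsOEOp k pt β Pc τ Fτ →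
        Fτ (fun i => Polynomial.C lam * u i + Polynomial.C mu)
          = fun i => Polynomial.C lam * Fτ u i + Polynomial.C mu) := by
  refine ⟨fun j m _ => sigma_C_mul_add_C k hpt u hlam mu m j,
    fun w hw => hw.C_mul_add_C hpt hPc hlam mu, fun Fτ hF => ?_⟩
  obtain ⟨w, hw, hFw⟩ := hF u hu
  obtain ⟨w', hw', hFw'⟩ := hF (fun i => Polynomial.C lam * u i + Polynomial.C mu)
    fun i => natDegree_C_mul_add_C_le (hu i) lam mu
  rw [hFw, hFw', hw'.unique hpt hPc (hw.C_mul_add_C hpt hPc hlam mu)]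

end OEDG
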